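/- arXiv:1205.6347 — 5 statements merged into one kernel-verified Lean document; each statement's English description precedes it below -/
import Mathlib

section
/- Let n and k be integers with 2 ≤ k ≤ n. Let v ∈ ℤ^{n+1} be the vector with first coordinate n + k, coordinates 2 through k equal to n, and all remaining coordinates equal to 0. Then the class of v in ℤ^{n+1}/ℤ·(1,1,…,1) is divisible by k (i.e. there exist x ∈ ℤ^{n+1} and m ∈ ℤ with v = k·x + m·(1,1,…,1)) if and only if k divides n. -/
/-- **Divisibility of `c₁` of the flag manifold `(1, k−1, n+1−k)` in the weight lattice.**
For integers `2 ≤ k ≤ n`, the vector `v ∈ ℤ^{n+1}` with first coordinate `n + k`,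
coordinates `2` through `k` equal to `n`, and remaining coordinates `0`, is divisible
by `k` modulo the diagonal `ℤ·(1,…,1)` if and only if `k ∣ n`. -/
theorem flag_c1_divisible_iff (n k : ℕ) (hk : 2 ≤ k) (hkn : k ≤ n) :
    (∃ x : Fin (n + 1) → ℤ, ∃ m : ℤ, ∀ i : Fin (n + 1),
        (if i.val = 0 then ((n : ℤ) + k) else if i.val < k then (n : ℤ) else 0)
          = k * x i + m) ↔ k ∣ n := by
  constructor
  · rintro ⟨x, m, h⟩
    have h_first := h 0
    have h_last := h (Fin.last n)
    simp only [Fin.val_zero, if_true] at h_first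
    rw [Fin.val_last, if_neg (by omega), if_neg (by omega)] at h_last
    exact Int.natCast_dvd_natCast.mp
      ⟨x 0 - x (Fin.last n) - 1, by linear_combination h_first - h_last⟩
  · rintro ⟨d, rfl⟩
    refine ⟨fun i => if i.val = 0 then (d : ℤ) + 1 else if i.val < k then (d : ℤ) else 0, 0,
      fun i => ?_⟩
    dsimp only
    split_ifs <;> push_cast <;> ring
end

section
/- There exist R > 0, constants 0 < c₁ ≤ c₂ < ∞, and a smooth function α : {z ∈ ℂ⁴ : |z| > R} → ℂ such that c₁|z|^{-4} ≤ |α(z)| ≤ c₂|z|^{-4} for all z with |z| > R, and such that ∑_{i=1}^{4} (z_i + α(z)·\overline{z_i}^2)^3 = 1 for every z ∈ ℂ⁴ with ∑_{i=1}^{4} z_i^3 = 0 and |z| > R. -/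
open scoped Topology ContDiff ComplexConjugate

/-- Near the origin, the root of `w + b w² + c w³ = 1` close to `1` depends smoothly on `(b, c)`. -/
theorem exists_smooth_root_perturbed_cubic :
    ∃ ε > (0 : ℝ), ∃ W : ℂ × ℂ → ℂ, ContDiffOn ℝ ∞ W (Metric.ball 0 ε) ∧
      ∀ p ∈ Metric.ball (0 : ℂ × ℂ) ε,
        W p + p.1 * W p ^ 2 + p.2 * W p ^ 3 = 1 ∧ 1 / 2 ≤ ‖W p‖ ∧ ‖W p‖ ≤ 2 := by
  let f : (ℂ × ℂ) × ℂ → ℂ := fun q => q.2 + q.1.1 * q.2 ^ 2 + q.1.2 * q.2 ^ 3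
  have hf : ContDiffAt ℝ ω f (0, 1) := by
    apply ContDiff.contDiffAt
    fun_prop
  have hinv : (fderiv ℝ f (0, 1) ∘L .inr ℝ (ℂ × ℂ) ℂ).IsInvertible := by
    have hd : HasFDerivAt (fun w : ℂ => f (0, w)) (fderiv ℝ f (0, 1) ∘L .inr ℝ (ℂ × ℂ) ℂ) 1 :=
      (hf.differentiableAt (by simp)).hasFDerivAt.comp (1 : ℂ)
        (hasFDerivAt_prodMk_right (0 : ℂ × ℂ) (1 : ℂ))
    have he : (fun w : ℂ => f (0, w)) = id := by
      funext w
      simp [f]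
    rw [he] at hd
    rw [hd.unique (hasFDerivAt_id (1 : ℂ))]
    exact ⟨ContinuousLinearEquiv.refl ℝ ℂ, rfl⟩
  have hω : (ω : WithTop ℕ∞) ≠ 0 := by simp
  let W := hf.implicitFunction hω hinv
  have hW : ContDiffAt ℝ ω W 0 := hf.contDiffAt_implicitFunction hω hinv
  have hW0 : W 0 = 1 := hf.implicitFunction_apply_self hω hinv
  have hsmooth : ∀ᶠ p in 𝓝 (0 : ℂ × ℂ), ContDiffAt ℝ ω W p := hW.eventually (by simp)
  have hroot : ∀ᶠ p in 𝓝 (0 : ℂ × ℂ), f (p, W p) = f (0, 1) :=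
    hf.eventually_apply_implicitFunction hω hinv
  have hnorm : ∀ᶠ p in 𝓝 (0 : ℂ × ℂ), ‖W p‖ ∈ Set.Icc (1 / 2 : ℝ) 2 := by
    apply hW.continuousAt.norm
    simp only [hW0, norm_one]
    exact Icc_mem_nhds (by norm_num) (by norm_num)
  obtain ⟨ε, hε, hball⟩ := Metric.eventually_nhds_iff_ball.1 (hsmooth.and (hroot.and hnorm))
  refine ⟨ε, hε, W, fun p hp => ((hball p hp).1.of_le (by simp)).contDiffWithinAt,
    fun p hp => ⟨?_, (hball p hp).2.2⟩⟩
  simpa [f] using (hball p hp).2.1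

theorem ContDiffOn.complex_div {E : Type*} [NormedAddCommGroup E] [NormedSpace ℝ E]
    {n : WithTop ℕ∞} {s : Set E} {f g : E → ℂ} (hf : ContDiffOn ℝ n f s)
    (hg : ContDiffOn ℝ n g s) (h0 : ∀ x ∈ s, g x ≠ 0) :
    ContDiffOn ℝ n (fun x => f x / g x) s := by
  simp only [div_eq_mul_inv]
  exact hf.mul (hg.inv h0)

theorem norm_pow_four_le_sum (z : EuclideanSpace ℂ (Fin 4)) :
    ‖z‖ ^ 4 / 4 ≤ ∑ i, ‖z i‖ ^ 4 := by
  have h := sq_sum_le_card_mul_sum_sq (s := Finset.univ) (f := fun i => ‖z i‖ ^ 2)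
  rw [← EuclideanSpace.norm_sq_eq] at h
  simp only [Finset.card_univ, Fintype.card_fin, ← pow_mul] at h
  norm_num at h
  linarith

theorem sum_norm_pow_four_le (z : EuclideanSpace ℂ (Fin 4)) :
    ∑ i, ‖z i‖ ^ 4 ≤ ‖z‖ ^ 4 := by
  have h := Finset.sum_sq_le_sq_sum_of_nonneg (s := Finset.univ) (f := fun i => ‖z i‖ ^ 2)
    (fun i _ => by positivity)
  rw [← EuclideanSpace.norm_sq_eq] at h
  simpa only [← pow_mul] using h

theorem norm_sum_le_four_mul {z : EuclideanSpace ℂ (Fin 4)} {g : Fin 4 → ℂ} {n : ℕ}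
    (hg : ∀ i, ‖g i‖ = ‖z i‖ ^ n) : ‖∑ i, g i‖ ≤ 4 * ‖z‖ ^ n := by
  calc ‖∑ i, g i‖ ≤ ∑ _i : Fin 4, ‖z‖ ^ n := norm_sum_le_of_le _ fun i _ => by
        rw [hg]
        exact pow_le_pow_left₀ (norm_nonneg _) (PiLp.norm_apply_le z i) n
    _ = 4 * ‖z‖ ^ n := by simp

/-- On the cubic cone, `∑ (zᵢ + α z̄ᵢ²)³` is a cubic in `α` without constant term. -/
theorem sum_add_mul_conj_sq_cube (z : EuclideanSpace ℂ (Fin 4)) (a : ℂ)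
    (hz : ∑ i, z i ^ 3 = 0) :
    ∑ i, (z i + a * conj (z i) ^ 2) ^ 3 =
      3 * a * ((∑ i, ‖z i‖ ^ 4 : ℝ) : ℂ) + 3 * a ^ 2 * ∑ i, z i * conj (z i) ^ 4 +
        a ^ 3 * ∑ i, conj (z i) ^ 6 := by
  have h (i : Fin 4) : (z i + a * conj (z i) ^ 2) ^ 3 = z i ^ 3 +
      3 * a * ((‖z i‖ ^ 4 : ℝ) : ℂ) + 3 * a ^ 2 * (z i * conj (z i) ^ 4) +
        a ^ 3 * conj (z i) ^ 6 := by
    have hn : ((‖z i‖ ^ 4 : ℝ) : ℂ) = (z i * conj (z i)) ^ 2 := by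
      rw [Complex.mul_conj']
      push_cast
      ring
    rw [hn]
    ring
  simp only [h, Finset.sum_add_distrib, ← Finset.mul_sum, hz, zero_add, Complex.ofReal_sum]

/-- **Normal projection from the cubic cone in `ℂ⁴` to its smoothing.**
There exist `R > 0`, constants `0 < c₁ ≤ c₂` and a smooth function
`α : {|z| > R} → ℂ` with `c₁|z|⁻⁴ ≤ |α(z)| ≤ c₂|z|⁻⁴`, such that
`∑ (zᵢ + α(z)·conj(zᵢ)²)³ = 1` whenever `∑ zᵢ³ = 0` and `|z| > R`. -/
theorem cubic_cone_normal_projection :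
    ∃ R > (0 : ℝ), ∃ c₁ > (0 : ℝ), ∃ c₂ > (0 : ℝ), c₁ ≤ c₂ ∧
      ∃ α : EuclideanSpace ℂ (Fin 4) → ℂ,
        ContDiffOn ℝ (⊤ : ℕ∞) α {z : EuclideanSpace ℂ (Fin 4) | R < ‖z‖} ∧
        (∀ z : EuclideanSpace ℂ (Fin 4), R < ‖z‖ →
          c₁ * ‖z‖ ^ (-4 : ℤ) ≤ ‖α z‖ ∧ ‖α z‖ ≤ c₂ * ‖z‖ ^ (-4 : ℤ)) ∧
        (∀ z : EuclideanSpace ℂ (Fin 4), (∑ i, (z i) ^ 3) = 0 → R < ‖z‖ →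
          ∑ i, (z i + α z * ((starRingEnd ℂ) (z i)) ^ 2) ^ 3 = 1) := by
  obtain ⟨ε, hε, W, hWs, hW⟩ := exists_smooth_root_perturbed_cubic
  let S : EuclideanSpace ℂ (Fin 4) → ℝ := fun z => ∑ i, ‖z i‖ ^ 4
  let B : EuclideanSpace ℂ (Fin 4) → ℂ := fun z => ∑ i, z i * conj (z i) ^ 4
  let C : EuclideanSpace ℂ (Fin 4) → ℂ := fun z => ∑ i, conj (z i) ^ 6
  let p : EuclideanSpace ℂ (Fin 4) → ℂ × ℂ := fun z =>
    (B z / (3 * (S z : ℂ) ^ 2), C z / (27 * (S z : ℂ) ^ 3))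
  have hR1 : (1 : ℝ) < 1 + 22 / ε := by
    have : 0 < 22 / ε := by positivity
    linarith
  have hS (z : EuclideanSpace ℂ (Fin 4)) (hz : 1 + 22 / ε < ‖z‖) : 0 < S z :=
    lt_of_lt_of_le (by have : 0 < ‖z‖ := by linarith
                       positivity) (norm_pow_four_le_sum z)
  have hp (z : EuclideanSpace ℂ (Fin 4)) (hz : 1 + 22 / ε < ‖z‖) :
      p z ∈ Metric.ball 0 ε := by
    have hz1 : 1 < ‖z‖ := hR1.trans hz
    have hz0 : 0 < ‖z‖ := by linarith
    have hSz := hS z hz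
    have hSle : ‖z‖ ^ 4 / 4 ≤ S z := norm_pow_four_le_sum z
    have hεz : 22 < ε * ‖z‖ := by
      have : 22 / ε < ‖z‖ := by linarith
      rwa [div_lt_iff₀ hε, mul_comm] at this
    have hB : ‖B z‖ ≤ 4 * ‖z‖ ^ 5 := norm_sum_le_four_mul fun i => by
      rw [norm_mul, norm_pow, RCLike.norm_conj]
      ring
    have hC : ‖C z‖ ≤ 4 * ‖z‖ ^ 6 := norm_sum_le_four_mul fun i => by
      rw [norm_pow, RCLike.norm_conj]
    have hS2 : (‖z‖ ^ 4 / 4) ^ 2 ≤ S z ^ 2 := by gcongr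
    have hS3 : (‖z‖ ^ 4 / 4) ^ 3 ≤ S z ^ 3 := by gcongr
    rw [mem_ball_zero_iff, Prod.norm_def, max_lt_iff]
    constructor
    · simp only [p, norm_div, norm_mul, norm_pow, Complex.norm_real, Real.norm_of_nonneg hSz.le,
        Complex.norm_ofNat]
      rw [div_lt_iff₀ (by positivity)]
      have h1 : 22 * ‖z‖ ^ 7 < ε * ‖z‖ * ‖z‖ ^ 7 := by gcongr
      have h2 : ‖z‖ ^ 5 ≤ ‖z‖ ^ 7 := pow_le_pow_right₀ hz1.le (by norm_num)
      have h3 : ε * (‖z‖ ^ 4 / 4) ^ 2 ≤ ε * S z ^ 2 := by gcongr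
      have h4 : 0 < ‖z‖ ^ 5 := by positivity
      nlinarith
    · simp only [p, norm_div, norm_mul, norm_pow, Complex.norm_real, Real.norm_of_nonneg hSz.le,
        Complex.norm_ofNat]
      rw [div_lt_iff₀ (by positivity)]
      have h1 : 22 * ‖z‖ ^ 11 < ε * ‖z‖ * ‖z‖ ^ 11 := by gcongr
      have h2 : ‖z‖ ^ 6 ≤ ‖z‖ ^ 11 := pow_le_pow_right₀ hz1.le (by norm_num)
      have h3 : ε * (‖z‖ ^ 4 / 4) ^ 3 ≤ ε * S z ^ 3 := by gcongr
      have h4 : 0 < ‖z‖ ^ 6 := by positivity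
      nlinarith
  have hcoord (i : Fin 4) : ContDiff ℝ ∞ fun z : EuclideanSpace ℂ (Fin 4) => z i :=
    ((EuclideanSpace.proj i : EuclideanSpace ℂ (Fin 4) →L[ℂ] ℂ).restrictScalars ℝ).contDiff
  have hconj (i : Fin 4) : ContDiff ℝ ∞ fun z : EuclideanSpace ℂ (Fin 4) => conj (z i) :=
    Complex.conjCLE.contDiff.comp (hcoord i)
  have hSs : ContDiff ℝ ∞ fun z => (S z : ℂ) := by
    have : (fun z => (S z : ℂ)) = fun z => ∑ i, (z i * conj (z i)) ^ 2 := by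
      funext z
      simp only [S, Complex.ofReal_sum, Complex.mul_conj']
      push_cast
      simp only [← pow_mul]
    rw [this]
    exact ContDiff.sum fun i _ => ((hcoord i).mul (hconj i)).pow 2
  have hBs : ContDiff ℝ ∞ B := ContDiff.sum fun i _ => (hcoord i).mul ((hconj i).pow 4)
  have hCs : ContDiff ℝ ∞ C := ContDiff.sum fun i _ => (hconj i).pow 6
  have hS0 (z : EuclideanSpace ℂ (Fin 4)) (hz : 1 + 22 / ε < ‖z‖) : (S z : ℂ) ≠ 0 :=
    Complex.ofReal_ne_zero.2 (hS z hz).ne'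
  refine ⟨1 + 22 / ε, by linarith, 1 / 6, by norm_num, 8 / 3, by norm_num, by norm_num,
    fun z => W (p z) / (3 * (S z : ℂ)), ?_, fun z hz => ?_, fun z hz0 hz => ?_⟩
  · have hb : ContDiffOn ℝ ∞ (fun z => B z / (3 * (S z : ℂ) ^ 2)) {z | 1 + 22 / ε < ‖z‖} :=
      hBs.contDiffOn.complex_div (contDiff_const.mul (hSs.pow 2)).contDiffOn
        fun z hz => mul_ne_zero three_ne_zero (pow_ne_zero 2 (hS0 z hz))
    have hc : ContDiffOn ℝ ∞ (fun z => C z / (27 * (S z : ℂ) ^ 3)) {z | 1 + 22 / ε < ‖z‖} :=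
      hCs.contDiffOn.complex_div (contDiff_const.mul (hSs.pow 3)).contDiffOn
        fun z hz => mul_ne_zero (by norm_num) (pow_ne_zero 3 (hS0 z hz))
    exact (hWs.comp (hb.prodMk hc) hp).complex_div (contDiff_const.mul hSs).contDiffOn
      fun z hz => mul_ne_zero three_ne_zero (hS0 z hz)
  · obtain ⟨-, hlo, hhi⟩ := hW _ (hp z hz)
    have hSz := hS z hz
    have hlow : ‖z‖ ^ 4 / 4 ≤ S z := norm_pow_four_le_sum z
    have hupp : S z ≤ ‖z‖ ^ 4 := sum_norm_pow_four_le z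
    have hz4 : 0 < ‖z‖ ^ 4 := by linarith
    have hzpow : ‖z‖ ^ (-4 : ℤ) = (‖z‖ ^ 4)⁻¹ := by
      rw [zpow_neg]
      norm_cast
    rw [hzpow, norm_div, norm_mul, Complex.norm_real, Real.norm_of_nonneg hSz.le,
      Complex.norm_ofNat, ← div_eq_mul_inv, ← div_eq_mul_inv]
    constructor
    · rw [div_le_div_iff₀ hz4 (by positivity)]
      nlinarith
    · rw [div_le_div_iff₀ (by positivity) hz4]
      nlinarith
  · have hroot := (hW _ (hp z hz)).1
    have hSz : (S z : ℂ) ≠ 0 := hS0 z hz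
    rw [sum_add_mul_conj_sq_cube z _ hz0, ← hroot]
    change 3 * (W (p z) / (3 * (S z : ℂ))) * (S z : ℂ) +
      3 * (W (p z) / (3 * (S z : ℂ))) ^ 2 * B z + (W (p z) / (3 * (S z : ℂ))) ^ 3 * C z =
      W (p z) + B z / (3 * (S z : ℂ) ^ 2) * W (p z) ^ 2 +
        C z / (27 * (S z : ℂ) ^ 3) * W (p z) ^ 3
    generalize W (p z) = w
    field_simp
    ring
end

section
/- Let λ₁, …, λ₅ be pairwise distinct complex numbers. There exist R > 0, a constant C > 0, and smooth functions α, β : {z ∈ ℂ⁵ : |z| > R} → ℂ with |α(z)| ≤ C|z|^{-2} and |β(z)| ≤ C|z|^{-2} for all |z| > R, such that for every z ∈ ℂ⁵ with ∑_{i=1}^{5} z_i² = 0, ∑_{i=1}^{5} λ_i z_i² = 0 and |z| > R, the point w defined by w_i = z_i + (α(z) + \overline{λ_i} β(z))·\overline{z_i} satisfies ∑_{i=1}^{5} w_i² = 1 and ∑_{i=1}^{5} λ_i w_i² = 1. -/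
open scoped ContDiff

/-- The diagonal quadratic form `∑ cᵢ zᵢ²`. -/
noncomputable def diagQuadratic (c : Fin 5 → ℂ) (z : EuclideanSpace ℂ (Fin 5)) : ℂ :=
  ∑ i, c i * z i ^ 2

/-- The diagonal sesquilinear form `∑ cᵢ |zᵢ|²`. -/
noncomputable def diagHermitian (c : Fin 5 → ℂ) (z : EuclideanSpace ℂ (Fin 5)) : ℂ :=
  ∑ i, c i * (z i * (starRingEnd ℂ) (z i))

lemma contDiff_coord {n : ℕ∞ω} (i : Fin 5) :
    ContDiff ℝ n fun z : EuclideanSpace ℂ (Fin 5) => z i :=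
  ((EuclideanSpace.proj i : EuclideanSpace ℂ (Fin 5) →L[ℂ] ℂ).restrictScalars ℝ).contDiff

lemma ContDiff.starRingEnd_comp {E : Type*} [NormedAddCommGroup E] [NormedSpace ℝ E] {n : ℕ∞ω}
    {f : E → ℂ} (hf : ContDiff ℝ n f) : ContDiff ℝ n fun z => (starRingEnd ℂ) (f z) :=
  Complex.conjCLE.contDiff.comp hf

lemma contDiff_diagQuadratic {n : ℕ∞ω} (c : Fin 5 → ℂ) : ContDiff ℝ n (diagQuadratic c) :=
  ContDiff.sum fun i _ => contDiff_const.mul ((contDiff_coord i).pow 2)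

lemma contDiff_diagHermitian {n : ℕ∞ω} (c : Fin 5 → ℂ) : ContDiff ℝ n (diagHermitian c) :=
  ContDiff.sum fun i _ => contDiff_const.mul
    ((contDiff_coord i).mul (contDiff_coord i).starRingEnd_comp)

lemma diagQuadratic_smul (c : Fin 5 → ℂ) (t : ℝ) (z : EuclideanSpace ℂ (Fin 5)) :
    diagQuadratic c (t • z) = (t : ℂ) ^ 2 * diagQuadratic c z := by
  simp only [diagQuadratic, Finset.mul_sum, PiLp.smul_apply, Complex.real_smul]
  exact Finset.sum_congr rfl fun i _ => by ring

lemma diagHermitian_smul (c : Fin 5 → ℂ) (t : ℝ) (z : EuclideanSpace ℂ (Fin 5)) :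
    diagHermitian c (t • z) = (t : ℂ) ^ 2 * diagHermitian c z := by
  simp only [diagHermitian, Finset.mul_sum, PiLp.smul_apply, Complex.real_smul, map_mul,
    Complex.conj_ofReal]
  exact Finset.sum_congr rfl fun i _ => by ring

/-- The Gram determinant of `(conj zᵢ)ᵢ` and `(conj λᵢ conj zᵢ)ᵢ`, plus `|∑ zᵢ²|²`. The extra term
vanishes on the cone and makes the sum nonzero away from the origin. -/
noncomputable def gramDet (lam : Fin 5 → ℂ) (z : EuclideanSpace ℂ (Fin 5)) : ℂ :=
  diagHermitian 1 z * diagHermitian (fun i => lam i * (starRingEnd ℂ) (lam i)) z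
    - diagHermitian lam z * (starRingEnd ℂ) (diagHermitian lam z)
    + diagQuadratic 1 z * (starRingEnd ℂ) (diagQuadratic 1 z)

lemma contDiff_gramDet {n : ℕ∞ω} (lam : Fin 5 → ℂ) : ContDiff ℝ n (gramDet lam) :=
  (((contDiff_diagHermitian _).mul (contDiff_diagHermitian _)).sub
    ((contDiff_diagHermitian _).mul (contDiff_diagHermitian _).starRingEnd_comp)).add
    ((contDiff_diagQuadratic _).mul (contDiff_diagQuadratic _).starRingEnd_comp)

lemma gramDet_smul (lam : Fin 5 → ℂ) (t : ℝ) (z : EuclideanSpace ℂ (Fin 5)) :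
    gramDet lam (t • z) = (t : ℂ) ^ 4 * gramDet lam z := by
  simp only [gramDet, diagHermitian_smul, diagQuadratic_smul, map_mul, map_pow,
    Complex.conj_ofReal]
  ring

lemma two_mul_gramDet (lam : Fin 5 → ℂ) (z : EuclideanSpace ℂ (Fin 5)) :
    2 * gramDet lam z = (((∑ i, ∑ j, Complex.normSq (lam i - lam j) *
      (Complex.normSq (z i) * Complex.normSq (z j))) +
        2 * Complex.normSq (diagQuadratic 1 z) : ℝ) : ℂ) := by
  have lagrange : 2 * (diagHermitian 1 z *
        diagHermitian (fun i => lam i * (starRingEnd ℂ) (lam i)) z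
      - diagHermitian lam z * (starRingEnd ℂ) (diagHermitian lam z)) =
      ∑ i, ∑ j, (lam i - lam j) * ((starRingEnd ℂ) (lam i) - (starRingEnd ℂ) (lam j)) *
        ((z i * (starRingEnd ℂ) (z i)) * (z j * (starRingEnd ℂ) (z j))) := by
    simp only [diagHermitian, map_add, map_mul, Complex.conj_conj, Fin.sum_univ_five, Pi.one_apply]
    ring
  push_cast
  simp only [gramDet, ← Complex.mul_conj, map_sub]
  rw [← lagrange]
  ring

lemma gramDet_ne_zero {lam : Fin 5 → ℂ} (hlam : ∀ i j : Fin 5, i ≠ j → lam i ≠ lam j)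
    {z : EuclideanSpace ℂ (Fin 5)} (hz : z ≠ 0) : gramDet lam z ≠ 0 := by
  intro h
  have key := two_mul_gramDet lam z
  rw [h, mul_zero] at key
  have key := (Complex.ofReal_eq_zero.1 key.symm)
  have hnn : ∀ i j, 0 ≤ Complex.normSq (lam i - lam j) *
      (Complex.normSq (z i) * Complex.normSq (z j)) := fun i j =>
    mul_nonneg (Complex.normSq_nonneg _)
      (mul_nonneg (Complex.normSq_nonneg _) (Complex.normSq_nonneg _))
  have hq0 := Complex.normSq_nonneg (diagQuadratic 1 z)
  have hs0 := Finset.sum_nonneg fun i (_ : i ∈ Finset.univ) =>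
    Finset.sum_nonneg fun j (_ : j ∈ Finset.univ) => hnn i j
  have hq : diagQuadratic 1 z = 0 := Complex.normSq_eq_zero.1 (by linarith)
  have hs : ∑ i, ∑ j, Complex.normSq (lam i - lam j) *
      (Complex.normSq (z i) * Complex.normSq (z j)) = 0 := by linarith
  obtain ⟨i, hi⟩ : ∃ i, z i ≠ 0 := by
    by_contra! hc
    exact hz (by ext i; simpa using hc i)
  have hj : ∀ j, j ≠ i → z j = 0 := fun j hji => by
    have h1 := (Finset.sum_eq_zero_iff_of_nonneg fun i _ =>
      Finset.sum_nonneg fun j _ => hnn i j).1 hs i (Finset.mem_univ _)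
    have h2 := (Finset.sum_eq_zero_iff_of_nonneg fun j _ => hnn i j).1 h1 j (Finset.mem_univ _)
    simpa [hi, sub_eq_zero, hlam i j hji.symm] using h2
  rw [diagQuadratic, Finset.sum_eq_single i (fun j _ hji => by simp [hj j hji]) (by simp)] at hq
  exact hi (by simpa using hq)

/-- A continuous function on the punctured space that is homogeneous of degree `-1` is bounded by
a multiple of `‖z‖⁻¹`. -/
lemma exists_norm_le_mul_inv_of_homogeneous {V W : Type*} [NormedAddCommGroup V] [NormedSpace ℝ V]
    [ProperSpace V] [NormedAddCommGroup W] [NormedSpace ℝ W] {g : V → W}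
    (hg : ContinuousOn g {0}ᶜ) (hom : ∀ t : ℝ, 0 < t → ∀ z, g (t • z) = t⁻¹ • g z) :
    ∃ K > 0, ∀ z, z ≠ 0 → ‖g z‖ ≤ K * ‖z‖⁻¹ := by
  obtain ⟨K, hK⟩ := (isCompact_sphere (0 : V) 1).exists_bound_of_continuousOn
    (hg.mono fun z hz => by rintro rfl; simp at hz)
  refine ⟨max K 1, by positivity, fun z hz => ?_⟩
  have hz' : 0 < ‖z‖ := norm_pos_iff.2 hz
  have h1 : g z = ‖z‖⁻¹ • g (‖z‖⁻¹ • z) := by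
    rw [← hom _ hz', smul_smul, mul_inv_cancel₀ hz'.ne', one_smul]
  have h2 := hK (‖z‖⁻¹ • z) (by simp [norm_smul, hz'.ne'])
  rw [h1, norm_smul, norm_inv, norm_norm, mul_comm]
  gcongr
  exact h2.trans (le_max_left _ _)

/-- A map that is homogeneous of degree three has vanishing derivative at the origin. -/
lemma hasFDerivAt_zero_of_cubic {V W : Type*} [NormedAddCommGroup V] [NormedSpace ℝ V]
    [NormedAddCommGroup W] [NormedSpace ℝ W] {N : V → W} (hN : DifferentiableAt ℝ N 0)
    (hom : ∀ (t : ℝ) v, N (t • v) = t ^ 3 • N v) : HasFDerivAt N (0 : V →L[ℝ] W) 0 := by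
  have h := hN.hasFDerivAt
  suffices fderiv ℝ N 0 = 0 by rwa [this] at h
  ext v
  have hline : HasDerivAt (fun t : ℝ => t • v) v 0 := by
    simpa using (hasDerivAt_id (0 : ℝ)).smul_const v
  have h1 : HasDerivAt (fun t : ℝ => N (t • v)) (fderiv ℝ N 0 v) 0 :=
    HasFDerivAt.comp_hasDerivAt (0 : ℝ) (by simpa using h) hline
  have h2 : HasDerivAt (fun t : ℝ => N (t • v)) 0 0 := by
    simp only [hom]
    simpa using (hasDerivAt_pow 3 (0 : ℝ)).smul_const (N v)
  simpa using h1.unique h2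

/-- An analytic perturbation of the identity with vanishing derivative at the origin has an
analytic local right inverse of linear growth. -/
lemma exists_right_inverse_of_perturbation {V : Type*} [NormedAddCommGroup V] [NormedSpace ℝ V]
    [CompleteSpace V] {N : V → V} (hN : ContDiff ℝ ω N) (h0 : N 0 = 0)
    (hd : HasFDerivAt N (0 : V →L[ℝ] V) 0) :
    ∃ δ > 0, ∃ K > 0, ∃ φ : V → V, ∀ y, ‖y‖ < δ →
      ContDiffAt ℝ ω φ y ∧ φ y + N (φ y) = y ∧ ‖φ y‖ ≤ K * ‖y‖ := by
  let H : V → V := fun x => x + N x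
  have hH : ContDiffAt ℝ ω H 0 := (contDiff_id.add hN).contDiffAt
  have hH' : HasFDerivAt H (ContinuousLinearEquiv.refl ℝ V : V →L[ℝ] V) 0 := by
    simpa using! (hasFDerivAt_id (𝕜 := ℝ) (0 : V)).add hd
  have hH0 : H 0 = 0 := by simp [H, h0]
  have hs := hH.hasStrictFDerivAt' hH' (by simp)
  have hinv := hs.eventually_right_inverse
  have hφ0 := hH.localInverse_apply_image hH' (by simp)
  have hsm := hH.to_localInverse hH' (by simp)
  rw [hH0] at hinv hsm hφ0
  obtain ⟨K, hK, hO⟩ :=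
    ((hsm.differentiableAt (by simp)).hasFDerivAt.isBigO_sub).exists_pos
  obtain ⟨δ, hδ, hball⟩ := Metric.eventually_nhds_iff.1
    (((hsm.eventually (by simp)).and hinv).and hO.bound)
  refine ⟨δ, hδ, K, hK, hH.localInverse hH' (by simp), fun y hy => ?_⟩
  obtain ⟨⟨h1, h2⟩, h3⟩ := hball (by simpa using hy : dist y 0 < δ)
  exact ⟨h1, h2, by simpa [hφ0] using h3⟩

/-- A pair of quadratic polynomials in the last two variables, whose coefficients are the first
six variables. -/
def quadraticPair (x : Fin 8 → ℂ) : Fin 8 → ℂ :=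
  ![0, 0, 0, 0, 0, 0,
    x 0 * x 6 ^ 2 + x 1 * (x 6 * x 7) + x 2 * x 7 ^ 2,
    x 3 * x 6 ^ 2 + x 4 * (x 6 * x 7) + x 5 * x 7 ^ 2]

lemma contDiff_quadraticPair {n : ℕ∞ω} : ContDiff ℝ n quadraticPair := by
  rw [contDiff_pi]
  intro i
  fin_cases i <;> simp [quadraticPair] <;> fun_prop

lemma quadraticPair_smul (t : ℝ) (x : Fin 8 → ℂ) :
    quadraticPair (t • x) = t ^ 3 • quadraticPair x := by
  ext i
  fin_cases i <;> simp [quadraticPair] <;> ring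

/-- The coefficients and constant terms of the fixed point equation for
`(‖z‖ * α z, ‖z‖ * β z)`. -/
noncomputable def projectionData (lam : Fin 5 → ℂ) (z : EuclideanSpace ℂ (Fin 5)) : Fin 8 → ℂ :=
  let conj := starRingEnd ℂ
  let r : ℂ := ‖z‖
  let s₀ := diagHermitian 1 z
  let s₁ := diagHermitian lam z
  let s₂ := diagHermitian (fun i => lam i * conj (lam i)) z
  let k₁ := conj (diagQuadratic (fun i => lam i ^ 2) z)
  let k₂ := conj (diagQuadratic (fun i => conj (lam i)) z)
  let k₃ := conj (diagQuadratic (fun i => lam i * conj (lam i)) z)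
  let k₄ := conj (diagQuadratic (fun i => lam i ^ 2 * conj (lam i)) z)
  (2 * gramDet lam z * r)⁻¹ •
    ![-(conj s₁ * k₂), -(2 * (conj s₁ * k₃)), s₂ * k₁ - conj s₁ * k₄,
      s₀ * k₂, 2 * (s₀ * k₃), s₀ * k₄ - s₁ * k₁,
      r ^ 2 * (s₂ - conj s₁), r ^ 2 * (s₀ - s₁)]

lemma contDiffAt_projectionData {n : ℕ∞ω} {lam : Fin 5 → ℂ}
    (hlam : ∀ i j : Fin 5, i ≠ j → lam i ≠ lam j) {z : EuclideanSpace ℂ (Fin 5)} (hz : z ≠ 0) :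
    ContDiffAt ℝ n (projectionData lam) z := by
  have hr : ContDiffAt ℝ n (fun z : EuclideanSpace ℂ (Fin 5) => (‖z‖ : ℂ)) z :=
    Complex.ofRealCLM.contDiff.contDiffAt.comp z (contDiffAt_norm ℂ hz)
  have hD : ContDiffAt ℝ n (gramDet lam) z := (contDiff_gramDet lam).contDiffAt
  have hh (c) : ContDiffAt ℝ n (diagHermitian c) z := (contDiff_diagHermitian c).contDiffAt
  have hh' (c) : ContDiffAt ℝ n (fun z => (starRingEnd ℂ) (diagHermitian c z)) z :=
    (contDiff_diagHermitian c).starRingEnd_comp.contDiffAt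
  have hq' (c) : ContDiffAt ℝ n (fun z => (starRingEnd ℂ) (diagQuadratic c z)) z :=
    (contDiff_diagQuadratic c).starRingEnd_comp.contDiffAt
  have hm : ContDiffAt ℝ n (fun z => (2 * gramDet lam z * (‖z‖ : ℂ))⁻¹) z :=
    ((contDiffAt_const.mul hD).mul hr).inv (by simp [gramDet_ne_zero hlam hz, hz])
  refine hm.smul ?_
  rw [contDiffAt_pi]
  intro i
  fin_cases i <;> simp <;> fun_prop

lemma projectionData_smul (lam : Fin 5 → ℂ) (t : ℝ) (ht : 0 < t)
    (z : EuclideanSpace ℂ (Fin 5)) : projectionData lam (t • z) = t⁻¹ • projectionData lam z := by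
  have ht' : (t : ℂ) ≠ 0 := by exact_mod_cast ht.ne'
  have hr : ((‖t • z‖ : ℝ) : ℂ) = t * ‖z‖ := by simp [norm_smul, abs_of_pos ht]
  have hc : (2 * ((t : ℂ) ^ 4 * gramDet lam z) * (t * ‖z‖))⁻¹ =
      (t : ℂ)⁻¹ * ((t : ℂ)⁻¹ ^ 4 * (2 * gramDet lam z * ‖z‖)⁻¹) := by
    simp only [mul_inv, inv_pow]
    ring
  ext i
  simp only [projectionData, gramDet_smul, diagHermitian_smul, diagQuadratic_smul, hr, hc,
    map_mul, map_pow, Complex.conj_ofReal, Pi.smul_apply, Complex.real_smul, smul_eq_mul,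
    Complex.ofReal_inv]
  generalize (2 * gramDet lam z * ‖z‖)⁻¹ = m
  fin_cases i <;> simp <;> field_simp

/-- Cramer's rule for the pair of equations satisfied by `a / r` and `b / r`. -/
lemma solve_of_cramer {s₀ s₁ s₁' s₂ k₁ k₂ k₃ k₄ D r a b : ℂ} (hD : D ≠ 0) (hr : r ≠ 0)
    (hdet : D = s₀ * s₂ - s₁ * s₁')
    (ha : 2 * D * r * a + (-(s₁' * k₂) * a ^ 2 + -(2 * (s₁' * k₃)) * (a * b)
      + (s₂ * k₁ - s₁' * k₄) * b ^ 2) = r ^ 2 * (s₂ - s₁'))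
    (hb : 2 * D * r * b + (s₀ * k₂ * a ^ 2 + 2 * (s₀ * k₃) * (a * b)
      + (s₀ * k₄ - s₁ * k₁) * b ^ 2) = r ^ 2 * (s₀ - s₁)) :
    2 * (a / r * s₀ + b / r * s₁') + (b / r) ^ 2 * k₁ = 1 ∧
    2 * (a / r * s₁ + b / r * s₂) + (a / r) ^ 2 * k₂ + 2 * (a / r) * (b / r) * k₃
      + (b / r) ^ 2 * k₄ = 1 := by
  constructor
  · field_simp
    apply mul_left_cancel₀ hD
    linear_combination s₀ * ha + s₁' * hb + (r ^ 2 - k₁ * b ^ 2) * (-hdet)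
  · field_simp
    apply mul_left_cancel₀ hD
    linear_combination s₁ * ha + s₂ * hb
      + (r ^ 2 - (k₂ * a ^ 2 + 2 * k₃ * a * b + k₄ * b ^ 2)) * (-hdet)

/-- Solutions of the fixed point equation give points of the smoothing. -/
lemma projection_mem_smoothing {lam : Fin 5 → ℂ}
    (hlam : ∀ i j : Fin 5, i ≠ j → lam i ≠ lam j) {z : EuclideanSpace ℂ (Fin 5)} (hz : z ≠ 0)
    (h₁ : ∑ i, (z i) ^ 2 = 0) (h₂ : ∑ i, lam i * (z i) ^ 2 = 0) {x : Fin 8 → ℂ}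
    (hx : x + quadraticPair x = projectionData lam z) :
    (∑ i, (z i + (x 6 / ‖z‖ + (starRingEnd ℂ) (lam i) * (x 7 / ‖z‖)) *
      (starRingEnd ℂ) (z i)) ^ 2 = 1) ∧
    (∑ i, lam i * (z i + (x 6 / ‖z‖ + (starRingEnd ℂ) (lam i) * (x 7 / ‖z‖)) *
      (starRingEnd ℂ) (z i)) ^ 2 = 1) := by
  have hD := gramDet_ne_zero hlam hz
  have hr : (‖z‖ : ℂ) ≠ 0 := by simpa using hz
  have hdet : gramDet lam z =
      diagHermitian 1 z * diagHermitian (fun i => lam i * (starRingEnd ℂ) (lam i)) z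
        - diagHermitian lam z * (starRingEnd ℂ) (diagHermitian lam z) := by
    simp [gramDet, diagQuadratic, h₁]
  have hm : 2 * gramDet lam z * ‖z‖ ≠ 0 := by simp [hD, hz]
  have e (i) := congrFun hx i
  simp only [projectionData, Pi.add_apply, Pi.smul_apply, smul_eq_mul] at e
  have e0 := e 0
  have e1 := e 1
  have e2 := e 2
  have e3 := e 3
  have e4 := e 4
  have e5 := e 5
  have e6 := e 6
  have e7 := e 7
  simp only [quadraticPair, Matrix.cons_val, add_zero] at e0 e1 e2 e3 e4 e5 e6 e7
  rw [eq_inv_mul_iff_mul_eq₀ hm] at e0 e1 e2 e3 e4 e5 e6 e7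
  obtain ⟨E₁, E₂⟩ := solve_of_cramer hD hr hdet (a := x 6) (b := x 7)
    (by rw [← e0, ← e1, ← e2, ← e6]; ring) (by rw [← e3, ← e4, ← e5, ← e7]; ring)
  have h₁' := congrArg (starRingEnd ℂ) h₁
  have h₂' := congrArg (starRingEnd ℂ) h₂
  simp only [diagHermitian, diagQuadratic, map_add, map_mul, map_pow, map_zero, Complex.conj_conj,
    Fin.sum_univ_five, Pi.one_apply, one_mul] at h₁ h₂ h₁' h₂' E₁ E₂ ⊢
  generalize x 6 / (‖z‖ : ℂ) = a at *
  generalize x 7 / (‖z‖ : ℂ) = b at *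
  constructor
  · linear_combination E₁ + h₁ + a ^ 2 * h₁' + 2 * a * b * h₂'
  · linear_combination E₂ + h₂


/-- **Normal projection from the intersection of two quadric cones in `ℂ⁵` to its smoothing.**
Given pairwise distinct `λ₁, …, λ₅ ∈ ℂ`, there exist `R > 0`, `C > 0` and smooth
functions `α, β : {|z| > R} → ℂ` with `|α(z)|, |β(z)| ≤ C|z|⁻²`, such that for every
`z` on the cone `{∑ zᵢ² = 0, ∑ λᵢ zᵢ² = 0}` with `|z| > R`, the point
`wᵢ = zᵢ + (α(z) + conj(λᵢ)β(z))·conj(zᵢ)` satisfies `∑ wᵢ² = 1` and `∑ λᵢ wᵢ² = 1`. -/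
theorem quadric_cone_normal_projection (lam : Fin 5 → ℂ)
    (hlam : ∀ i j : Fin 5, i ≠ j → lam i ≠ lam j) :
    ∃ R > (0 : ℝ), ∃ C > (0 : ℝ),
      ∃ α β : EuclideanSpace ℂ (Fin 5) → ℂ,
        ContDiffOn ℝ (⊤ : ℕ∞) α {z : EuclideanSpace ℂ (Fin 5) | R < ‖z‖} ∧
        ContDiffOn ℝ (⊤ : ℕ∞) β {z : EuclideanSpace ℂ (Fin 5) | R < ‖z‖} ∧
        (∀ z : EuclideanSpace ℂ (Fin 5), R < ‖z‖ →
          ‖α z‖ ≤ C * ‖z‖ ^ (-2 : ℤ) ∧ ‖β z‖ ≤ C * ‖z‖ ^ (-2 : ℤ)) ∧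
        (∀ z : EuclideanSpace ℂ (Fin 5),
          (∑ i, (z i) ^ 2) = 0 → (∑ i, lam i * (z i) ^ 2) = 0 → R < ‖z‖ →
          (∑ i, (z i + (α z + (starRingEnd ℂ) (lam i) * β z) * (starRingEnd ℂ) (z i)) ^ 2 = 1) ∧
          (∑ i, lam i *
              (z i + (α z + (starRingEnd ℂ) (lam i) * β z) * (starRingEnd ℂ) (z i)) ^ 2 = 1)) := by
  obtain ⟨δ, hδ, K, hK, φ, hφ⟩ := exists_right_inverse_of_perturbation contDiff_quadraticPair
    (by simpa using quadraticPair_smul 0 0)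
    (hasFDerivAt_zero_of_cubic
      ((contDiff_quadraticPair (n := 1)).differentiable (by simp)).differentiableAt
      quadraticPair_smul)
  obtain ⟨L, hL, hbound⟩ := exists_norm_le_mul_inv_of_homogeneous (g := projectionData lam)
    (fun z hz => (contDiffAt_projectionData (n := 0) hlam hz).continuousAt.continuousWithinAt)
    (projectionData_smul lam)
  have hne : ∀ z : EuclideanSpace ℂ (Fin 5), L / δ < ‖z‖ → z ≠ 0 := fun z hz =>
    norm_pos_iff.1 ((div_pos hL hδ).trans hz)
  have hsmall : ∀ z : EuclideanSpace ℂ (Fin 5), L / δ < ‖z‖ → ‖projectionData lam z‖ < δ :=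
    fun z hz => by
      refine (hbound z (hne z hz)).trans_lt ?_
      rw [← div_eq_mul_inv, div_lt_iff₀ (norm_pos_iff.2 (hne z hz)), mul_comm]
      exact (div_lt_iff₀ hδ).1 hz
  have hsmooth (i : Fin 8) : ContDiffOn ℝ (⊤ : ℕ∞)
      (fun z : EuclideanSpace ℂ (Fin 5) => φ (projectionData lam z) i / ‖z‖)
      {z : EuclideanSpace ℂ (Fin 5) | L / δ < ‖z‖} := fun z hz => by
    have h1 := ((hφ _ (hsmall z hz)).1.of_le le_top).comp z
      (contDiffAt_projectionData (n := (⊤ : ℕ∞)) hlam (hne z hz))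
    have h2 : ContDiffAt ℝ (⊤ : ℕ∞) (fun z : EuclideanSpace ℂ (Fin 5) => (‖z‖ : ℂ)) z :=
      Complex.ofRealCLM.contDiff.contDiffAt.comp z (contDiffAt_norm ℂ (hne z hz))
    have h3 : (‖z‖ : ℂ) ≠ 0 := by simpa using hne z hz
    simp only [div_eq_mul_inv]
    exact ((contDiffAt_pi.1 h1 i).mul (h2.inv h3)).contDiffWithinAt
  have hdecay (i : Fin 8) (z : EuclideanSpace ℂ (Fin 5)) (hz : L / δ < ‖z‖) :
      ‖φ (projectionData lam z) i / (‖z‖ : ℂ)‖ ≤ K * L * ‖z‖ ^ (-2 : ℤ) := by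
    have h1 := (norm_le_pi_norm (φ (projectionData lam z)) i).trans (hφ _ (hsmall z hz)).2.2
    have h2 := mul_le_mul_of_nonneg_left (hbound z (hne z hz)) hK.le
    rw [norm_div, Complex.norm_real, norm_norm, div_eq_mul_inv]
    calc _ ≤ K * (L * ‖z‖⁻¹) * ‖z‖⁻¹ := by gcongr; exact h1.trans h2
      _ = _ := by rw [zpow_neg, zpow_ofNat]; ring
  exact ⟨L / δ, div_pos hL hδ, K * L, mul_pos hK hL, _, _, hsmooth 6, hsmooth 7,
    fun z hz => ⟨hdecay 6 z hz, hdecay 7 z hz⟩, fun z h₁ h₂ hz =>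
      projection_mem_smoothing hlam (hne z hz) h₁ h₂ (hφ _ (hsmall z hz)).2.1⟩
end

section
/- Fix an integer n ≥ 1 and let Φ : ℂ^{n+1} \ {0} → ℂ^{n+1} be defined by Φ(z)_i = z_i + \overline{z_i}/(2|z|²). Then for every z ∈ ℂ^{n+1} with z ≠ 0 and ∑_{i=1}^{n+1} z_i² = 0, one has ∑_{i=1}^{n+1} Φ(z)_i² = 1 and ∑_{i=1}^{n+1} |Φ(z)_i|² = |z|² + 1/(4|z|²); in particular Φ maps the punctured cone {z ≠ 0 : ∑ z_i² = 0} into the smoothing {w ∈ ℂ^{n+1} : ∑ w_i² = 1}, and τ∘Φ = τ·(1 + (2τ)^{-2}) where τ(z) = |z|². -/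
open scoped ComplexConjugate in
/-- On the null cone, the bilinear square of `z + c • conj z` only retains its cross term. -/
theorem sum_add_mul_conj_sq_of_sum_sq_eq_zero {ι : Type*} [Fintype ι]
    (z : EuclideanSpace ℂ ι) (hcone : ∑ i, (z i) ^ 2 = 0) (c : ℂ) :
    ∑ i, (z i + c * conj (z i)) ^ 2 = 2 * c * (‖z‖ : ℂ) ^ 2 := by
  have hconj : ∑ i, (conj (z i)) ^ 2 = 0 := by
    simpa using congrArg conj hcone
  have hnorm : (‖z‖ : ℂ) ^ 2 = ∑ i, z i * conj (z i) := by
    simp_rw [Complex.mul_conj']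
    exact_mod_cast EuclideanSpace.norm_sq_eq z
  calc ∑ i, (z i + c * conj (z i)) ^ 2
      = ∑ i, (z i ^ 2 + 2 * c * (z i * conj (z i)) + c ^ 2 * conj (z i) ^ 2) :=
        Finset.sum_congr rfl fun i _ => by ring
    _ = 2 * c * (‖z‖ : ℂ) ^ 2 := by
        rw [Finset.sum_add_distrib, Finset.sum_add_distrib, ← Finset.mul_sum, ← Finset.mul_sum,
          hcone, hconj, hnorm]
        ring

open scoped ComplexConjugate in
/-- On the null cone, `z` and `conj z` are orthogonal, so `z + r • conj z` has squared norm
`(1 + r ^ 2) * ‖z‖ ^ 2` for real `r`. -/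
theorem sum_norm_add_mul_conj_sq_of_sum_sq_eq_zero {ι : Type*} [Fintype ι]
    (z : EuclideanSpace ℂ ι) (hcone : ∑ i, (z i) ^ 2 = 0) (r : ℝ) :
    ∑ i, ‖z i + r * conj (z i)‖ ^ 2 = (1 + r ^ 2) * ‖z‖ ^ 2 := by
  have hre : ∑ i, (z i ^ 2).re = 0 := by
    rw [← Complex.re_sum, hcone, Complex.zero_re]
  calc ∑ i, ‖z i + r * conj (z i)‖ ^ 2
      = ∑ i, ((1 + r ^ 2) * ‖z i‖ ^ 2 + 2 * r * (z i ^ 2).re) :=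
        Finset.sum_congr rfl fun i _ => by
          rw [Complex.sq_norm, Complex.sq_norm]
          simp only [Complex.normSq_apply, pow_two, Complex.add_re,
            Complex.add_im, Complex.mul_re, Complex.mul_im, Complex.conj_re, Complex.conj_im,
            Complex.ofReal_re, Complex.ofReal_im]
          ring
    _ = (1 + r ^ 2) * ‖z‖ ^ 2 := by
        rw [Finset.sum_add_distrib, ← Finset.mul_sum, ← Finset.mul_sum, hre,
          EuclideanSpace.norm_sq_eq, mul_zero, add_zero]

/-- **The normal projection map for the ordinary double point.**
For `Φ(z)ᵢ = zᵢ + conj(zᵢ)/(2|z|²)` and any nonzero `z` on the cone `{∑ zᵢ² = 0}`,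
one has `∑ Φ(z)ᵢ² = 1` (so `Φ` maps the punctured cone into the smoothing
`{∑ wᵢ² = 1}`) and `∑ |Φ(z)ᵢ|² = |z|² + 1/(4|z|²)`, i.e. `τ∘Φ = τ(1 + (2τ)⁻²)`
with `τ = |z|²`. -/
theorem odp_normal_projection_identities (n : ℕ) (hn : 1 ≤ n)
    (z : EuclideanSpace ℂ (Fin (n + 1))) (hz : z ≠ 0)
    (hcone : ∑ i, (z i) ^ 2 = 0) :
    (∑ i, (z i + (starRingEnd ℂ) (z i) / (2 * (‖z‖ : ℂ) ^ 2)) ^ 2 = 1) ∧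
    (∑ i, ‖z i + (starRingEnd ℂ) (z i) / (2 * (‖z‖ : ℂ) ^ 2)‖ ^ 2
        = ‖z‖ ^ 2 + 1 / (4 * ‖z‖ ^ 2)) := by
  have hnorm : ‖z‖ ≠ 0 := norm_ne_zero_iff.mpr hz
  have hdiv (i : Fin (n + 1)) : (starRingEnd ℂ) (z i) / (2 * (‖z‖ : ℂ) ^ 2)
      = ((1 / (2 * ‖z‖ ^ 2) : ℝ) : ℂ) * (starRingEnd ℂ) (z i) := by
    push_cast
    ring
  simp_rw [hdiv]
  constructor
  · have hnorm' : (‖z‖ : ℂ) ≠ 0 := Complex.ofReal_ne_zero.mpr hnorm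
    rw [sum_add_mul_conj_sq_of_sum_sq_eq_zero z hcone]
    push_cast
    field_simp
  · rw [sum_norm_add_mul_conj_sq_of_sum_sq_eq_zero z hcone]
    field_simp
    ring
end

section
/- Fix an integer n ≥ 2 and define h : [0, ∞) → ℝ by h(w) = ∫₀^w ( ∫₀^s (sinh u)^{n−1} du )^{1/n} ds. Then there exist constants C > 0, D ∈ ℝ, and a nonzero real constant c such that, setting k(w) := (h(w) − D) / ( C·(cosh w)^{(n−1)/n} ) − 1, one has: h(w)/(cosh w)^{(n−1)/n} → C as w → ∞, and (i) if n = 2 then k(w)·cosh w → c; (ii) if n = 3 then k(w)·(cosh w)² / log(cosh w) → c; (iii) if n ≥ 4 then k(w)·(cosh w)² → c, as w → ∞. -/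
open Filter Real

/-- A primitive of a function comparable at infinity to the derivative of a function decreasing
to zero converges, at a rate given by l'Hôpital's rule. -/
theorem exists_tendsto_sub_div_of_tendsto_deriv_div {u v u' v' : ℝ → ℝ} {l : ℝ}
    (hu : ∀ᶠ x in atTop, HasDerivAt u (u' x) x) (hu' : Continuous u')
    (hv : ∀ᶠ x in atTop, HasDerivAt v (v' x) x) (hv' : ∀ᶠ x in atTop, v' x < 0)
    (hv0 : Tendsto v atTop (nhds 0))
    (h : Tendsto (fun x => u' x / v' x) atTop (nhds l)) :
    ∃ D, Tendsto u atTop (nhds D) ∧ Tendsto (fun x => (u x - D) / v x) atTop (nhds l) := by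
  obtain ⟨b, hb⟩ := eventually_atTop.1 (hu.and (hv.and hv'))
  have hvint : MeasureTheory.IntegrableOn v' (Set.Ioi b) :=
    MeasureTheory.integrableOn_Ioi_deriv_of_nonpos' (fun x hx => (hb x hx).2.1)
      (fun x hx => (hb x (le_of_lt hx)).2.2.le) hv0
  have hO : u' =O[atTop] v' :=
    Asymptotics.isBigO_of_div_tendsto_nhds
      (hv'.mono fun x hx h0 => absurd h0 hx.ne) l h
  have huint : MeasureTheory.IntegrableOn u' (Set.Ioi b) :=
    ((hu'.locallyIntegrable.locallyIntegrableOn (Set.Ici b)).integrableOn_of_isBigO_atTop hO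
      ⟨Set.Ioi b, Ioi_mem_atTop b, hvint⟩).mono_set Set.Ioi_subset_Ici_self
  obtain ⟨D, hD⟩ : ∃ D, Tendsto u atTop (nhds D) :=
    ⟨_, MeasureTheory.tendsto_limUnder_of_hasDerivAt_of_integrableOn_Ioi
      (fun x hx => (hb x (le_of_lt hx)).1) huint⟩
  refine ⟨D, hD, ?_⟩
  refine HasDerivAt.lhopital_zero_atTop (hu.mono fun x hx => hx.sub_const D) hv
    (hv'.mono fun x hx => hx.ne) ?_ hv0 h
  simpa using hD.sub_const D

theorem tendsto_sinh_atTop : Tendsto Real.sinh atTop atTop :=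
  tendsto_atTop_mono' _ ((eventually_ge_atTop 0).mono fun _ hx => Real.self_le_sinh_iff.2 hx)
    tendsto_id

theorem tendsto_cosh_atTop : Tendsto Real.cosh atTop atTop :=
  tendsto_atTop_mono (fun x => (Real.sinh_lt_cosh x).le) tendsto_sinh_atTop

theorem tendsto_cosh_div_sinh_atTop :
    Tendsto (fun x => Real.cosh x / Real.sinh x) atTop (nhds 1) := by
  have h : Tendsto (fun x => 1 + Real.exp (-x) / Real.sinh x) atTop (nhds (1 + 0)) :=
    ((tendsto_exp_neg_atTop_nhds_zero).div_atTop tendsto_sinh_atTop).const_add 1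
  rw [add_zero] at h
  refine h.congr' ?_
  filter_upwards [eventually_gt_atTop 0] with x hx
  have := Real.sinh_pos_iff.2 hx
  rw [← Real.cosh_sub_sinh]
  field_simp
  ring

theorem integral_sinh_pow_eq (n : ℕ) (hn : 2 ≤ n) (s : ℝ) :
    ∫ u in (0 : ℝ)..s, Real.sinh u ^ (n - 1) =
      (Real.sinh s ^ n / Real.cosh s
        - ∫ u in (0 : ℝ)..s, Real.sinh u ^ (n - 1) / Real.cosh u ^ 2) / (n - 1) := by
  obtain ⟨m, rfl⟩ : ∃ m, n = m + 1 := ⟨n - 1, by omega⟩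
  have hm : (m : ℝ) ≠ 0 := by
    have : m ≠ 0 := by omega
    exact_mod_cast this
  have hc : ∀ x : ℝ, Real.cosh x ≠ 0 := fun x => (Real.cosh_pos x).ne'
  have hd : ∀ x ∈ Set.uIcc 0 s, HasDerivAt (fun u => Real.sinh u ^ (m + 1) / Real.cosh u)
      ((m : ℝ) * Real.sinh x ^ m + Real.sinh x ^ m / Real.cosh x ^ 2) x := by
    intro x _
    refine (((Real.hasDerivAt_sinh x).fun_pow (m + 1)).fun_div
      (Real.hasDerivAt_cosh x) (hc x)).congr_deriv ?_
    have := hc x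
    rw [Nat.add_sub_cancel]
    field_simp
    push_cast
    have h2 := Real.cosh_sq x
    linear_combination Real.sinh x ^ m * h2
  have i1 : Continuous fun x => (m : ℝ) * Real.sinh x ^ m := by fun_prop
  have i2 : Continuous fun x => Real.sinh x ^ m / Real.cosh x ^ 2 :=
    (by fun_prop : Continuous fun x => Real.sinh x ^ m).div (by fun_prop)
      fun x => pow_ne_zero _ (hc x)
  have h := intervalIntegral.integral_eq_sub_of_hasDerivAt hd
    ((i1.add i2).intervalIntegrable _ _)
  rw [intervalIntegral.integral_add (i1.intervalIntegrable _ _) (i2.intervalIntegrable _ _),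
    intervalIntegral.integral_const_mul] at h
  simp only [Nat.add_sub_cancel]
  push_cast
  simp at h
  rw [← h, add_sub_cancel_right, add_sub_cancel_right, mul_div_cancel_left₀ _ hm]

/-- If the defect of `∫ sinh ^ (n - 1)` from its leading term has relative size `L * ψ`, then the
potential has an expansion with relative error of size a multiple of `ψ`. -/
theorem stenzel_potential_expansion (n : ℕ) (hn : 2 ≤ n) {ψ ψ' : ℝ → ℝ} {b L β : ℝ}
    (hψ : ∀ᶠ x in atTop, HasDerivAt ψ (ψ' x) x) (hψ0 : ∀ᶠ x in atTop, 0 < ψ x)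
    (hb : Tendsto (fun x => Real.cosh x * ψ x) atTop (nhds b))
    (hβ : Tendsto (fun x => ψ' x / ψ x) atTop (nhds (-β))) (hβ1 : 1 ≤ β) (hL : L ≠ 0)
    (hR : Tendsto (fun x => (Real.cosh x / Real.sinh x ^ n *
      ∫ u in (0 : ℝ)..x, Real.sinh u ^ (n - 1) / Real.cosh u ^ 2) / ψ x) atTop (nhds L)) :
    ∃ C > (0 : ℝ), ∃ D : ℝ, ∃ c : ℝ, c ≠ 0 ∧
      Tendsto
        (fun w : ℝ =>
          (∫ s in (0 : ℝ)..w, (∫ u in (0 : ℝ)..s, Real.sinh u ^ (n - 1)) ^ ((1 : ℝ) / n))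
            / Real.cosh w ^ (((n : ℝ) - 1) / n))
        atTop (nhds C) ∧
      Tendsto
        (fun w : ℝ =>
          (((∫ s in (0 : ℝ)..w,
                (∫ u in (0 : ℝ)..s, Real.sinh u ^ (n - 1)) ^ ((1 : ℝ) / n)) - D)
            / (C * Real.cosh w ^ (((n : ℝ) - 1) / n)) - 1) / ψ w)
        atTop (nhds c) := by
  have hn2 : (2 : ℝ) ≤ n := by exact_mod_cast hn
  set a : ℝ := ((n : ℝ) - 1) / n with ha
  set p : ℝ := (1 : ℝ) / n with hp
  set F : ℝ → ℝ := fun s => ∫ u in (0 : ℝ)..s, Real.sinh u ^ (n - 1) with hF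
  set K : ℝ → ℝ := fun x => Real.cosh x / Real.sinh x ^ n *
      ∫ u in (0 : ℝ)..x, Real.sinh u ^ (n - 1) / Real.cosh u ^ 2 with hK
  have hp0 : 0 < p := by positivity
  have hap : a = 1 - p := by rw [ha, hp]; field_simp
  have hp1 : p < 1 := by rw [hp, div_lt_one (by linarith)]; linarith
  have ha0 : 0 < a := by linarith
  set B : ℝ := (1 / ((n : ℝ) - 1)) ^ p with hB
  have hB0 : 0 < B := Real.rpow_pos_of_pos (by apply one_div_pos.2; linarith) _
  set C : ℝ := B / a with hC
  have hC0 : 0 < C := by positivity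
  have hc : ∀ x : ℝ, 0 < Real.cosh x := Real.cosh_pos
  have hFc : Continuous F :=
    intervalIntegral.continuous_primitive
      (fun a b => (by fun_prop : Continuous fun u => Real.sinh u ^ (n - 1)).intervalIntegrable a b) 0
  have hFpc : Continuous fun s => F s ^ p := hFc.rpow_const fun _ => Or.inr hp0.le
  have hh : ∀ x, HasDerivAt (fun w => ∫ s in (0 : ℝ)..w, F s ^ p) (F x ^ p) x := fun x =>
    intervalIntegral.integral_hasDerivAt_right (hFpc.intervalIntegrable _ _)
      (hFpc.stronglyMeasurableAtFilter _ _) hFpc.continuousAt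
  have hg : ∀ x, HasDerivAt (fun w => Real.cosh w ^ a) (Real.sinh x * a * Real.cosh x ^ (-p)) x := by
    intro x
    have := (Real.hasDerivAt_cosh x).rpow_const (p := a) (Or.inl (hc x).ne')
    rwa [show a - 1 = -p by linarith] at this
  have hψt : Tendsto ψ atTop (nhds 0) := by
    refine (hb.div_atTop tendsto_cosh_atTop).congr fun x => ?_
    have := (hc x).ne'
    field_simp
  have hKt : Tendsto K atTop (nhds 0) := by
    have := hR.mul hψt
    rw [mul_zero] at this
    refine this.congr' (hψ0.mono fun x hx => ?_)
    exact div_mul_cancel₀ _ hx.ne'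
  have hFK : ∀ᶠ x in atTop, F x ^ p = B * Real.sinh x * Real.cosh x ^ (-p) * (1 - K x) ^ p := by
    filter_upwards [hKt.eventually (gt_mem_nhds one_pos), eventually_gt_atTop 0] with x hx hx0
    have hs := Real.sinh_pos_iff.2 hx0
    have h1 : F x = (1 / ((n : ℝ) - 1)) * (Real.sinh x ^ n * (Real.cosh x)⁻¹ * (1 - K x)) := by
      rw [hF]
      simp only
      rw [integral_sinh_pow_eq n hn, hK]
      have := (hc x).ne'
      have : (n : ℝ) - 1 ≠ 0 := by linarith
      field_simp
    have h2 : (0 : ℝ) ≤ 1 / ((n : ℝ) - 1) := one_div_nonneg.2 (by linarith)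
    have h3 : 0 ≤ 1 - K x := by linarith
    have h4 : 0 ≤ (Real.cosh x)⁻¹ := (inv_pos.2 (hc x)).le
    rw [h1, Real.mul_rpow h2 (by positivity), Real.mul_rpow (by positivity) h3,
      Real.mul_rpow (by positivity) h4, Real.inv_rpow (hc x).le, ← Real.rpow_neg (hc x).le, hp,
      one_div (n : ℝ), Real.pow_rpow_inv_natCast hs.le (by omega), hB, hp]
    simp only [one_div]
    ring
  have hpow : Tendsto (fun x => ((1 - K x) ^ p - 1) / ψ x) atTop (nhds (-(L * p))) := by
    have hd : HasDerivAt (fun y : ℝ => y ^ p) p 1 := by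
      simpa using Real.hasDerivAt_rpow_const (p := p) (Or.inl (one_ne_zero (α := ℝ)))
    have hds : ContinuousAt (dslope (fun y : ℝ => y ^ p) 1) 1 :=
      continuousAt_dslope_same.2 hd.differentiableAt
    have h1K : Tendsto (fun x => 1 - K x) atTop (nhds 1) := by simpa using hKt.const_sub 1
    have h1 := hds.tendsto.comp h1K
    rw [dslope_same, hd.deriv] at h1
    refine ((hR.mul h1).neg).congr fun x => ?_
    have h2 := sub_smul_dslope (fun y : ℝ => y ^ p) 1 (1 - K x)
    simp only [Real.one_rpow, smul_eq_mul] at h2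
    rw [← h2]
    simp only [Function.comp]
    ring
  have hcoth := tendsto_cosh_div_sinh_atTop
  have hw : Tendsto (fun x => a + Real.cosh x / Real.sinh x * (ψ' x / ψ x)) atTop
      (nhds (a - β)) := by
    simpa [sub_eq_add_neg] using (hcoth.mul hβ).const_add a
  have haβ : a - β < 0 := by linarith
  have hv' : ∀ᶠ x in atTop, Real.sinh x * a * Real.cosh x ^ (-p) * ψ x + Real.cosh x ^ a * ψ' x =
      Real.sinh x * Real.cosh x ^ (-p) * ψ x *
        (a + Real.cosh x / Real.sinh x * (ψ' x / ψ x)) := by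
    filter_upwards [hψ0, eventually_gt_atTop 0] with x hx hx0
    have hs := (Real.sinh_pos_iff.2 hx0).ne'
    rw [show a = 1 + -p by linarith, Real.rpow_add (hc x), Real.rpow_one]
    field_simp
  have hvpos : ∀ᶠ x in atTop, 0 < Real.sinh x * Real.cosh x ^ (-p) * ψ x := by
    filter_upwards [hψ0, eventually_gt_atTop 0] with x hx hx0
    have hs := Real.sinh_pos_iff.2 hx0
    have := hc x
    positivity
  obtain ⟨D, hD, hlim⟩ := exists_tendsto_sub_div_of_tendsto_deriv_div
    (u := fun w => (∫ s in (0 : ℝ)..w, F s ^ p) - C * Real.cosh w ^ a)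
    (u' := fun x => F x ^ p - C * (Real.sinh x * a * Real.cosh x ^ (-p)))
    (v := fun w => Real.cosh w ^ a * ψ w)
    (v' := fun x => Real.sinh x * a * Real.cosh x ^ (-p) * ψ x + Real.cosh x ^ a * ψ' x)
    (l := B * -(L * p) / (a - β))
    (Eventually.of_forall fun x => (hh x).sub ((hg x).const_mul C))
    (by
      refine hFpc.sub (continuous_const.mul ((by fun_prop : Continuous fun x =>
        Real.sinh x * a).mul ?_))
      exact Real.continuous_cosh.rpow_const fun x => Or.inl (hc x).ne')
    (hψ.mono fun x hx => (hg x).mul hx)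
    (by
      filter_upwards [hv', hvpos, hw.eventually (gt_mem_nhds haβ)] with x h1 h2 h3
      rw [h1]
      exact mul_neg_of_pos_of_neg h2 h3)
    (by
      have h1 := ((tendsto_rpow_neg_atTop hp0).comp tendsto_cosh_atTop).mul hb
      rw [zero_mul] at h1
      refine h1.congr fun x => ?_
      rw [show a = 1 + -p by linarith, Real.rpow_add (hc x), Real.rpow_one]
      simp only [Function.comp]
      ring)
    (by
      refine ((hpow.const_mul B).div hw haβ.ne).congr' ?_
      filter_upwards [hv', hvpos, hw.eventually (gt_mem_nhds haβ), hFK, hψ0,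
        eventually_gt_atTop 0] with x h1 h2 h3 h4 h5 h6
      have hs := (Real.sinh_pos_iff.2 h6).ne'
      have hcp := (Real.rpow_pos_of_pos (hc x) (-p)).ne'
      rw [h1, h4, hC, show B * Real.sinh x * Real.cosh x ^ (-p) * (1 - K x) ^ p -
          B / a * (Real.sinh x * a * Real.cosh x ^ (-p)) =
          (Real.sinh x * Real.cosh x ^ (-p) * ψ x) * (B * (((1 - K x) ^ p - 1) / ψ x)) by
            field_simp, mul_div_mul_left _ _ h2.ne']
      rfl)
  refine ⟨C, hC0, D, B * -(L * p) / (a - β) / C, ?_, ?_, ?_⟩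
  · exact div_ne_zero (div_ne_zero (mul_ne_zero hB0.ne' (neg_ne_zero.2
      (mul_ne_zero hL hp0.ne'))) haβ.ne) hC0.ne'
  · have h1 := (hD.div_atTop ((tendsto_rpow_atTop ha0).comp tendsto_cosh_atTop)).add_const C
    rw [zero_add] at h1
    refine h1.congr fun x => ?_
    have := (Real.rpow_pos_of_pos (hc x) a).ne'
    simp only [Function.comp]
    field_simp
    ring
  · refine (hlim.div_const C).congr' (hψ0.mono fun x hx => ?_)
    have := (Real.rpow_pos_of_pos (hc x) a).ne'
    field_simp
    ring

theorem tendsto_inv_cosh_atTop : Tendsto (fun x => (Real.cosh x)⁻¹) atTop (nhds 0) :=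
  tendsto_cosh_atTop.inv_tendsto_atTop

theorem tendsto_log_cosh_atTop : Tendsto (fun x => Real.log (Real.cosh x)) atTop atTop :=
  Real.tendsto_log_atTop.comp tendsto_cosh_atTop

theorem tendsto_sinh_div_cosh_atTop :
    Tendsto (fun x => Real.sinh x / Real.cosh x) atTop (nhds 1) := by
  simpa using tendsto_cosh_div_sinh_atTop.inv₀ one_ne_zero

theorem integral_sinh_div_cosh_sq (s : ℝ) :
    ∫ u in (0 : ℝ)..s, Real.sinh u / Real.cosh u ^ 2 = 1 - (Real.cosh s)⁻¹ := by
  have hc : ∀ x : ℝ, Real.cosh x ≠ 0 := fun x => (Real.cosh_pos x).ne'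
  have hd : ∀ x ∈ Set.uIcc 0 s, HasDerivAt (fun u => -(Real.cosh u)⁻¹)
      (Real.sinh x / Real.cosh x ^ 2) x := fun x _ => by
    refine ((Real.hasDerivAt_cosh x).fun_inv (hc x)).fun_neg.congr_deriv ?_
    ring
  have i : Continuous fun x => Real.sinh x / Real.cosh x ^ 2 :=
    Real.continuous_sinh.div (by fun_prop) fun x => pow_ne_zero _ (hc x)
  rw [intervalIntegral.integral_eq_sub_of_hasDerivAt hd (i.intervalIntegrable _ _)]
  simp
  ring

theorem integral_sinh_sq_div_cosh_sq (s : ℝ) :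
    ∫ u in (0 : ℝ)..s, Real.sinh u ^ 2 / Real.cosh u ^ 2 = s - Real.sinh s / Real.cosh s := by
  have hc : ∀ x : ℝ, Real.cosh x ≠ 0 := fun x => (Real.cosh_pos x).ne'
  have hd : ∀ x ∈ Set.uIcc 0 s, HasDerivAt (fun u => u - Real.sinh u / Real.cosh u)
      (Real.sinh x ^ 2 / Real.cosh x ^ 2) x := fun x _ => by
    refine ((hasDerivAt_id' x).fun_sub
      ((Real.hasDerivAt_sinh x).fun_div (Real.hasDerivAt_cosh x) (hc x))).congr_deriv ?_
    have := hc x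
    field_simp
    ring
  have i : Continuous fun x => Real.sinh x ^ 2 / Real.cosh x ^ 2 :=
    (by fun_prop : Continuous fun x => Real.sinh x ^ 2).div (by fun_prop)
      fun x => pow_ne_zero _ (hc x)
  rw [intervalIntegral.integral_eq_sub_of_hasDerivAt hd (i.intervalIntegrable _ _)]
  simp

theorem integral_sinh_pow_div_cosh_sq (n : ℕ) (hn : 1 ≤ n) (s : ℝ) :
    ((n : ℝ) - 3) * ∫ u in (0 : ℝ)..s, Real.sinh u ^ (n - 1) / Real.cosh u ^ 2 =
      Real.sinh s ^ n / Real.cosh s ^ 3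
        - 3 * ∫ u in (0 : ℝ)..s, Real.sinh u ^ (n - 1) / Real.cosh u ^ 4 := by
  obtain ⟨m, rfl⟩ : ∃ m, n = m + 1 := ⟨n - 1, by omega⟩
  have hc : ∀ x : ℝ, Real.cosh x ≠ 0 := fun x => (Real.cosh_pos x).ne'
  have hd : ∀ x ∈ Set.uIcc 0 s, HasDerivAt (fun u => Real.sinh u ^ (m + 1) / Real.cosh u ^ 3)
      (((m + 1 : ℕ) - 3 : ℝ) * (Real.sinh x ^ m / Real.cosh x ^ 2)
        + 3 * (Real.sinh x ^ m / Real.cosh x ^ 4)) x := by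
    intro x _
    refine (((Real.hasDerivAt_sinh x).fun_pow (m + 1)).fun_div
      ((Real.hasDerivAt_cosh x).fun_pow 3) (pow_ne_zero 3 (hc x))).congr_deriv ?_
    have := hc x
    rw [Nat.add_sub_cancel]
    field_simp
    push_cast
    have h2 := Real.cosh_sq x
    linear_combination (3 * Real.sinh x ^ m * Real.cosh x ^ 2) * h2
  have hi : ∀ k : ℕ, Continuous fun x => Real.sinh x ^ m / Real.cosh x ^ k := fun k =>
    (by fun_prop : Continuous fun x => Real.sinh x ^ m).div (by fun_prop)
      fun x => pow_ne_zero _ (hc x)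
  have h := intervalIntegral.integral_eq_sub_of_hasDerivAt hd
    ((((hi 2).const_mul _).add ((hi 4).const_mul _)).intervalIntegrable _ _)
  rw [intervalIntegral.integral_add (((hi 2).const_mul _).intervalIntegrable _ _)
    (((hi 4).const_mul _).intervalIntegrable _ _),
    intervalIntegral.integral_const_mul, intervalIntegral.integral_const_mul] at h
  rw [Nat.add_sub_cancel, eq_sub_iff_add_eq, h]
  simp

theorem integral_sinh_pow_div_cosh_pow_four_le (n : ℕ) (hn : 4 ≤ n) {s : ℝ} (hs : 0 ≤ s) :
    ∫ u in (0 : ℝ)..s, Real.sinh u ^ (n - 1) / Real.cosh u ^ 4 ≤ s * Real.cosh s ^ (n - 4) := by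
  have hc : ∀ x : ℝ, 0 < Real.cosh x := Real.cosh_pos
  have i : Continuous fun x => Real.sinh x ^ (n - 1) / Real.cosh x ^ 4 :=
    (by fun_prop : Continuous fun x => Real.sinh x ^ (n - 1)).div (by fun_prop)
      fun x => pow_ne_zero _ (hc x).ne'
  have h := intervalIntegral.integral_mono_on hs (i.intervalIntegrable 0 s)
    (intervalIntegrable_const (μ := MeasureTheory.volume) (c := Real.cosh s ^ (n - 4))) ?_
  · simpa using h
  intro x hx
  have hsx := Real.sinh_nonneg_iff.2 hx.1
  have h1 : Real.cosh x ≤ Real.cosh s :=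
    Real.cosh_le_cosh.2 (by rw [abs_of_nonneg hx.1, abs_of_nonneg hs]; exact hx.2)
  rw [div_le_iff₀ (pow_pos (hc x) 4)]
  calc Real.sinh x ^ (n - 1) ≤ Real.cosh x ^ (n - 1) :=
        pow_le_pow_left₀ hsx (Real.sinh_lt_cosh x).le _
    _ ≤ Real.cosh x ^ n := pow_le_pow_right₀ (Real.one_le_cosh x) (by omega)
    _ = Real.cosh x ^ (n - 4) * Real.cosh x ^ 4 := by rw [← pow_add]; congr 1; omega
    _ ≤ Real.cosh s ^ (n - 4) * Real.cosh x ^ 4 := by gcongr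

theorem tendsto_id_div_cosh_atTop : Tendsto (fun x => x / Real.cosh x) atTop (nhds 0) := by
  have h : Tendsto (fun x : ℝ => 2 * (x ^ 1 * Real.exp (-x))) atTop (nhds (2 * 0)) :=
    (Real.tendsto_pow_mul_exp_neg_atTop_nhds_zero 1).const_mul 2
  rw [mul_zero] at h
  refine squeeze_zero' ?_ ?_ h
  · filter_upwards [eventually_ge_atTop 0] with x hx using div_nonneg hx (Real.cosh_pos x).le
  · filter_upwards [eventually_ge_atTop 0] with x hx
    rw [div_le_iff₀ (Real.cosh_pos x), Real.cosh_eq]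
    have h1 : Real.exp (-x) * Real.exp x = 1 := by rw [← Real.exp_add]; simp
    have h2 : 0 ≤ x * Real.exp (-x) ^ 2 := by positivity
    linear_combination h2 - x * h1

theorem tendsto_id_div_log_cosh_atTop :
    Tendsto (fun x => x / Real.log (Real.cosh x)) atTop (nhds 1) := by
  have hl := tendsto_log_cosh_atTop
  have h : Tendsto (fun x => 1 + Real.log 2 / Real.log (Real.cosh x)) atTop (nhds (1 + 0)) :=
    (tendsto_const_nhds.div_atTop hl).const_add 1
  rw [add_zero] at h
  refine tendsto_of_tendsto_of_tendsto_of_le_of_le' tendsto_const_nhds h ?_ ?_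
  · filter_upwards [hl.eventually_gt_atTop 0, eventually_ge_atTop 0] with x hx hx0
    rw [le_div_iff₀ hx, one_mul, Real.log_le_iff_le_exp (Real.cosh_pos x), Real.cosh_eq]
    have : Real.exp (-x) ≤ Real.exp x := Real.exp_le_exp.2 (by linarith)
    linarith
  · filter_upwards [hl.eventually_gt_atTop 0] with x hx
    rw [div_le_iff₀ hx, add_mul, one_mul, div_mul_cancel₀ _ hx.ne',
      ← Real.log_mul (Real.cosh_pos x).ne' two_ne_zero,
      Real.le_log_iff_exp_le (mul_pos (Real.cosh_pos x) two_pos), Real.cosh_eq]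
    have := Real.exp_pos (-x)
    linarith

theorem tendsto_integral_sinh_pow_div_cosh_sq (n : ℕ) (hn : 4 ≤ n) :
    Tendsto (fun x => Real.cosh x ^ 3 / Real.sinh x ^ n *
      ∫ u in (0 : ℝ)..x, Real.sinh u ^ (n - 1) / Real.cosh u ^ 2) atTop
      (nhds (1 / ((n : ℝ) - 3))) := by
  have hc : ∀ x : ℝ, 0 < Real.cosh x := Real.cosh_pos
  have hn4 : (4 : ℝ) ≤ n := by exact_mod_cast hn
  have hrem : Tendsto (fun x => Real.cosh x ^ 3 / Real.sinh x ^ n *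
      ∫ u in (0 : ℝ)..x, Real.sinh u ^ (n - 1) / Real.cosh u ^ 4) atTop (nhds 0) := by
    have h := (tendsto_cosh_div_sinh_atTop.pow n).mul tendsto_id_div_cosh_atTop
    rw [mul_zero] at h
    refine squeeze_zero' ?_ ?_ h
    · filter_upwards [eventually_gt_atTop 0] with x hx
      have hs := Real.sinh_pos_iff.2 hx
      refine mul_nonneg (div_nonneg (pow_pos (hc x) _).le (pow_pos hs _).le)
        (intervalIntegral.integral_nonneg hx.le fun u hu => ?_)
      exact div_nonneg (pow_nonneg (Real.sinh_nonneg_iff.2 hu.1) _) (pow_pos (hc u) _).le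
    · filter_upwards [eventually_gt_atTop 0] with x hx
      have hs := Real.sinh_pos_iff.2 hx
      have h0 := hc x
      calc _ ≤ Real.cosh x ^ 3 / Real.sinh x ^ n * (x * Real.cosh x ^ (n - 4)) := by
            gcongr
            exact integral_sinh_pow_div_cosh_pow_four_le n hn hx.le
        _ = _ := by
            obtain ⟨m, rfl⟩ : ∃ m, n = m + 4 := ⟨n - 4, by omega⟩
            rw [Nat.add_sub_cancel, div_pow]
            field_simp
            ring
  have h := ((hrem.const_mul 3).const_sub 1).div_const ((n : ℝ) - 3)
  rw [mul_zero, sub_zero] at h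
  refine h.congr' ?_
  filter_upwards [eventually_gt_atTop 0] with x hx
  have hs := (Real.sinh_pos_iff.2 hx).ne'
  have h0 := (hc x).ne'
  have h3 : (n : ℝ) - 3 ≠ 0 := by linarith
  rw [div_eq_iff h3, mul_assoc, mul_comm _ ((n : ℝ) - 3),
    integral_sinh_pow_div_cosh_sq n (by omega)]
  field_simp

theorem hasDerivAt_inv_cosh_sq (x : ℝ) :
    HasDerivAt (fun x => (Real.cosh x ^ 2)⁻¹) (-2 * Real.sinh x / Real.cosh x ^ 3) x := by
  have h0 := (Real.cosh_pos x).ne'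
  refine (((Real.hasDerivAt_cosh x).fun_pow 2).fun_inv (pow_ne_zero 2 h0)).congr_deriv ?_
  field_simp
  norm_num
  ring

/-- **Asymptotics of the Stenzel potential.**
For `n ≥ 2` let `h(w) = ∫₀ʷ (∫₀ˢ (sinh u)^{n−1} du)^{1/n} ds`. Then there are
`C > 0`, `D ∈ ℝ` and `c ≠ 0` such that, with
`k(w) = (h(w) − D)/(C (cosh w)^{(n−1)/n}) − 1`:
`h(w)/(cosh w)^{(n−1)/n} → C`, and `k(w)·cosh w → c` if `n = 2`,
`k(w)·(cosh w)²/log(cosh w) → c` if `n = 3`, and `k(w)·(cosh w)² → c` if `n ≥ 4`,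
as `w → ∞`. -/
theorem stenzel_potential_asymptotics (n : ℕ) (hn : 2 ≤ n) :
    ∃ C > (0 : ℝ), ∃ D : ℝ, ∃ c : ℝ, c ≠ 0 ∧
      Tendsto
        (fun w : ℝ =>
          (∫ s in (0 : ℝ)..w, (∫ u in (0 : ℝ)..s, Real.sinh u ^ (n - 1)) ^ ((1 : ℝ) / n))
            / Real.cosh w ^ (((n : ℝ) - 1) / n))
        atTop (nhds C) ∧
      ((n = 2 →
        Tendsto
          (fun w : ℝ =>
            (((∫ s in (0 : ℝ)..w,
                  (∫ u in (0 : ℝ)..s, Real.sinh u ^ (n - 1)) ^ ((1 : ℝ) / n)) - D)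
              / (C * Real.cosh w ^ (((n : ℝ) - 1) / n)) - 1) * Real.cosh w)
          atTop (nhds c)) ∧
      (n = 3 →
        Tendsto
          (fun w : ℝ =>
            (((∫ s in (0 : ℝ)..w,
                  (∫ u in (0 : ℝ)..s, Real.sinh u ^ (n - 1)) ^ ((1 : ℝ) / n)) - D)
              / (C * Real.cosh w ^ (((n : ℝ) - 1) / n)) - 1) * Real.cosh w ^ 2
            / Real.log (Real.cosh w))
          atTop (nhds c)) ∧
      (4 ≤ n →
        Tendsto
          (fun w : ℝ =>
            (((∫ s in (0 : ℝ)..w,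
                  (∫ u in (0 : ℝ)..s, Real.sinh u ^ (n - 1)) ^ ((1 : ℝ) / n)) - D)
              / (C * Real.cosh w ^ (((n : ℝ) - 1) / n)) - 1) * Real.cosh w ^ 2)
          atTop (nhds c))) := by
  have hc : ∀ x : ℝ, 0 < Real.cosh x := Real.cosh_pos
  obtain rfl | rfl | hn4 : n = 2 ∨ n = 3 ∨ 4 ≤ n := by omega
  · obtain ⟨C, hC, D, c, hc0, h1, h2⟩ := stenzel_potential_expansion 2 hn
      (ψ := fun x => (Real.cosh x)⁻¹) (ψ' := fun x => -Real.sinh x / Real.cosh x ^ 2)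
      (b := 1) (L := 1) (β := 1)
      (Eventually.of_forall fun x => (Real.hasDerivAt_cosh x).inv (hc x).ne')
      (Eventually.of_forall fun x => inv_pos.2 (hc x))
      (tendsto_const_nhds.congr fun x => (mul_inv_cancel₀ (hc x).ne').symm)
      (tendsto_sinh_div_cosh_atTop.neg.congr fun x => by
        have := (hc x).ne'
        field_simp)
      le_rfl one_ne_zero
      (by
        have h := (tendsto_cosh_div_sinh_atTop.pow 2).mul (tendsto_inv_cosh_atTop.const_sub 1)
        rw [sub_zero, one_pow, mul_one] at h
        refine h.congr fun x => ?_
        norm_num only [pow_one, integral_sinh_div_cosh_sq]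
        have := (hc x).ne'
        field_simp)
    refine ⟨C, hC, D, c, hc0, h1, fun _ => ?_, by omega, by omega⟩
    simpa only [div_inv_eq_mul] using h2
  · have hl := tendsto_log_cosh_atTop
    obtain ⟨C, hC, D, c, hc0, h1, h2⟩ := stenzel_potential_expansion 3 hn
      (ψ := fun x => Real.log (Real.cosh x) * (Real.cosh x ^ 2)⁻¹)
      (ψ' := fun x => Real.sinh x / Real.cosh x * (Real.cosh x ^ 2)⁻¹ +
        Real.log (Real.cosh x) * (-2 * Real.sinh x / Real.cosh x ^ 3))
      (b := 0) (L := 1) (β := 2)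
      (Eventually.of_forall fun x =>
        ((Real.hasDerivAt_cosh x).log (hc x).ne').mul (hasDerivAt_inv_cosh_sq x))
      (by
        filter_upwards [hl.eventually_gt_atTop 0] with x hx
        have := hc x
        positivity)
      (by
        have h := Real.isLittleO_log_id_atTop.tendsto_div_nhds_zero.comp tendsto_cosh_atTop
        refine h.congr fun x => ?_
        have := (hc x).ne'
        simp only [Function.comp, id]
        field_simp)
      (by
        have h := (tendsto_sinh_div_cosh_atTop.div_atTop hl).sub
          (tendsto_sinh_div_cosh_atTop.const_mul 2)
        rw [zero_sub, mul_one] at h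
        refine h.congr' ?_
        filter_upwards [hl.eventually_gt_atTop 0] with x hx
        have := (hc x).ne'
        have := hx.ne'
        field_simp
        ring)
      one_le_two one_ne_zero
      (by
        have h := (tendsto_cosh_div_sinh_atTop.pow 3).mul (tendsto_id_div_log_cosh_atTop.sub
          (tendsto_sinh_div_cosh_atTop.div_atTop hl))
        rw [sub_zero, one_pow, mul_one] at h
        refine h.congr' ?_
        filter_upwards [hl.eventually_gt_atTop 0, eventually_gt_atTop 0] with x hx hx0
        norm_num only [integral_sinh_sq_div_cosh_sq]
        have := (hc x).ne'
        have := hx.ne'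
        have := (Real.sinh_pos_iff.2 hx0).ne'
        field_simp)
    refine ⟨C, hC, D, c, hc0, h1, by omega, fun _ => ?_, by omega⟩
    refine h2.congr fun x => ?_
    rw [div_mul_eq_div_div_swap, div_inv_eq_mul]
  · obtain ⟨C, hC, D, c, hc0, h1, h2⟩ := stenzel_potential_expansion n hn
      (ψ := fun x => (Real.cosh x ^ 2)⁻¹) (ψ' := fun x => -2 * Real.sinh x / Real.cosh x ^ 3)
      (b := 0) (L := 1 / ((n : ℝ) - 3)) (β := 2)
      (Eventually.of_forall hasDerivAt_inv_cosh_sq)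
      (Eventually.of_forall fun x => inv_pos.2 (pow_pos (hc x) 2))
      (tendsto_inv_cosh_atTop.congr fun x => by
        have := (hc x).ne'
        field_simp)
      (by
        have h := tendsto_sinh_div_cosh_atTop.const_mul (-2)
        rw [mul_one] at h
        refine h.congr fun x => ?_
        have := (hc x).ne'
        field_simp)
      one_le_two
      (by
        have : (4 : ℝ) ≤ n := by exact_mod_cast hn4
        exact one_div_ne_zero (by linarith))
      ((tendsto_integral_sinh_pow_div_cosh_sq n hn4).congr fun x => by
        have := (hc x).ne'
        field_simp)
    refine ⟨C, hC, D, c, hc0, h1, by omega, by omega, fun _ => ?_⟩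
    simpa only [div_inv_eq_mul] using h2
end
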